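/- Assume (SH) and let x:[t₀,T]→ℝⁿ be a solution of the differential inclusion x'(s)∈F(x(s)) a.e. with x(t₀)=x₀. If for almost every t ∈ [t₀,T] there exists p(t) ∈ ℝⁿ such that ⟨p(t), x'(t)⟩ = H(x(t),p(t)) and (H(x(t),p(t)), −p(t)) ∈ ∂⁺V(t,x(t)), then x is optimal for the Mayer problem P(t₀,x₀). -/

import Mathlib

open MeasureTheory Filter Metric Set Topology
open scoped RealInnerProductSpace ENNReal NNReal Pointwise

noncomputable section

variable {E : Type*} [NormedAddCommGroup E] [InnerProductSpace ℝ E] [CompleteSpace E]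

/-- The Hamiltonian `H(x,p) = sup_{v ∈ F x} ⟪v,p⟫` associated with `F`. -/
def Ham (F : E → Set E) (x p : E) : ℝ :=
  sSup ((fun v => ⟪v, p⟫) '' F x)

/-- Standing hypotheses (SH): nonempty convex compact values, local Lipschitz continuity
with respect to the Hausdorff metric, and sublinear growth. -/
def StandingHyp (F : E → Set E) : Prop :=
  (∀ x, (F x).Nonempty ∧ Convex ℝ (F x) ∧ IsCompact (F x)) ∧
  (∀ x : E, ∃ ε > (0:ℝ), ∃ c : ℝ, 0 ≤ c ∧ ∀ y ∈ ball x ε, ∀ z ∈ ball x ε,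
    EMetric.hausdorffEdist (F y) (F z) ≤ ENNReal.ofReal (c * dist y z)) ∧
  (∃ r > (0:ℝ), ∀ x : E, ∀ v ∈ F x, ‖v‖ ≤ r * (1 + ‖x‖))

/-- `f` is semiconvex on `K` with constant `c`. -/
def SemiconvexWith (f : E → ℝ) (K : Set E) (c : ℝ) : Prop :=
  ∀ x h : E, x + h ∈ K → x - h ∈ K → -(c * ‖h‖ ^ 2) ≤ f (x + h) + f (x - h) - 2 * f x

/-- `f` is semiconcave on `K` with constant `c`. -/
def SemiconcaveWith (f : E → ℝ) (K : Set E) (c : ℝ) : Prop :=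
  ∀ x h : E, x + h ∈ K → x - h ∈ K → f (x + h) + f (x - h) - 2 * f x ≤ c * ‖h‖ ^ 2

def LocSemiconcave (f : E → ℝ) : Prop :=
  ∀ x : E, ∃ ε > (0:ℝ), ∃ c : ℝ, SemiconcaveWith f (ball x ε) c

def LocSemiconvex (f : E → ℝ) : Prop :=
  ∀ x : E, ∃ ε > (0:ℝ), ∃ c : ℝ, SemiconvexWith f (ball x ε) c

open scoped Classical in
/-- The gradient `∇ₚH(x,p)` of `H(x,·)` at `p` (junk value `0` if it does not exist). -/
def gradpH (F : E → Set E) (x p : E) : E :=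
  if h : ∃ g, HasGradientAt (fun q => Ham F x q) g p then h.choose else 0

/-- Hypothesis (H1): semiconvexity of `H(·,p)` with constant `c‖p‖` on compact convex sets,
existence of `∇ₚH(x,p)` for `p ≠ 0`, and local Lipschitz continuity of `x ↦ ∇ₚH(x,p)`,
uniformly for `p` in compact subsets of `ℝⁿ ∖ {0}`. -/
def HypH1 (F : E → Set E) : Prop :=
  (∀ K : Set E, K.Nonempty → Convex ℝ K → IsCompact K →
    ∃ c : ℝ, 0 ≤ c ∧ ∀ p : E, SemiconvexWith (fun x => Ham F x p) K (c * ‖p‖)) ∧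
  (∀ x p : E, p ≠ 0 → HasGradientAt (fun q => Ham F x q) (gradpH F x p) p) ∧
  (∀ K : Set E, K.Nonempty → Convex ℝ K → IsCompact K →
    ∀ P : Set E, IsCompact P → (0:E) ∉ P →
      ∃ L : ℝ≥0, ∀ p ∈ P, LipschitzOnWith L (fun x => gradpH F x p) K)

/-- Fréchet subdifferential `∂⁻f(x)`. -/
def FSub (f : E → ℝ) (x : E) : Set E :=
  {p | ∀ ε > (0:ℝ), ∀ᶠ y in 𝓝 x, -(ε * ‖y - x‖) ≤ f y - f x - ⟪p, y - x⟫}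

/-- Fréchet superdifferential `∂⁺f(x)`. -/
def FSuper (f : E → ℝ) (x : E) : Set E :=
  {p | ∀ ε > (0:ℝ), ∀ᶠ y in 𝓝 x, f y - f x - ⟪p, y - x⟫ ≤ ε * ‖y - x‖}

/-- Proximal superdifferential `∂^{+,pr}f(x)`. -/
def ProxSuper (f : E → ℝ) (x : E) : Set E :=
  {p | ∃ c : ℝ, 0 ≤ c ∧ ∃ ρ > (0:ℝ), ∀ y ∈ closedBall x ρ,
    f y - f x - ⟪p, y - x⟫ ≤ c * ‖y - x‖ ^ 2}

/-- Clarke's generalized gradient of `f` at `x`: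
`ζ ∈ ∂f(x)` iff `⟪ζ,v⟫ ≤ limsup_{y→x, h→0⁺} (f(y+hv)-f(y))/h` for all `v`. -/
def ClarkeGrad (f : E → ℝ) (x : E) : Set E :=
  {ζ | ∀ v : E, ∀ ε > (0:ℝ),
    ∃ᶠ q : E × ℝ in (𝓝 x) ×ˢ (𝓝[>] (0:ℝ)),
      ⟪ζ, v⟫ - ε ≤ (f (q.1 + q.2 • v) - f q.1) / q.2}

/-- `x` is absolutely continuous on `[t0,T]` with (a.e.) derivative `x'`. -/
def ACArc (t0 T : ℝ) (x x' : ℝ → E) : Prop :=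
  IntervalIntegrable x' volume t0 T ∧
  (∀ s ∈ Icc t0 T, x s = x t0 + ∫ r in t0..s, x' r) ∧
  (∀ᵐ s ∂volume, s ∈ Icc t0 T → HasDerivAt x (x' s) s)

/-- `x` is a trajectory of the differential inclusion `x' ∈ F(x)` on `[t0,T]`. -/
def IsTraj (F : E → Set E) (t0 T : ℝ) (x x' : ℝ → E) : Prop :=
  ACArc t0 T x x' ∧ ∀ᵐ s ∂volume, s ∈ Icc t0 T → x' s ∈ F (x s)

/-- `x` is an optimal trajectory for the Mayer problem `P(t0,x0)`. -/
def IsOptimal (F : E → Set E) (φ : E → ℝ) (t0 T : ℝ) (x0 : E) (x x' : ℝ → E) : Prop :=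
  IsTraj F t0 T x x' ∧ x t0 = x0 ∧
  ∀ y y' : ℝ → E, IsTraj F t0 T y y' → y t0 = x0 → φ (x T) ≤ φ (y T)

/-- The value function of the Mayer problem. -/
def valueFn (F : E → Set E) (φ : E → ℝ) (T t : ℝ) (x : E) : ℝ :=
  sInf {r | ∃ y y' : ℝ → E, IsTraj F t T y y' ∧ y t = x ∧ r = φ (y T)}

/-- Fréchet superdifferential of `W` in the pair `(t,x)`. -/
def FSuperPair (W : ℝ → E → ℝ) (t : ℝ) (x : E) : Set (ℝ × E) :=
  {q | ∀ ε > (0:ℝ), ∀ᶠ sy : ℝ × E in 𝓝 (t, x),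
    W sy.1 sy.2 - W t x - q.1 * (sy.1 - t) - ⟪q.2, sy.2 - x⟫ ≤
      ε * ‖((sy.1 - t, sy.2 - x) : ℝ × E)‖}

/-- Fréchet subdifferential of `W` in the pair `(t,x)`. -/
def FSubPair (W : ℝ → E → ℝ) (t : ℝ) (x : E) : Set (ℝ × E) :=
  {q | ∀ ε > (0:ℝ), ∀ᶠ sy : ℝ × E in 𝓝 (t, x),
    -(ε * ‖((sy.1 - t, sy.2 - x) : ℝ × E)‖) ≤
      W sy.1 sy.2 - W t x - q.1 * (sy.1 - t) - ⟪q.2, sy.2 - x⟫}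

/-- Proximal superdifferential of `W` in the pair `(t,x)`. -/
def ProxSuperPair (W : ℝ → E → ℝ) (t : ℝ) (x : E) : Set (ℝ × E) :=
  {q | ∃ c : ℝ, 0 ≤ c ∧ ∃ ρ > (0:ℝ), ∀ s : ℝ, ∀ y : E,
    dist ((s, y) : ℝ × E) ((t, x) : ℝ × E) ≤ ρ →
      W s y - W t x - q.1 * (s - t) - ⟪q.2, y - x⟫ ≤ c * ‖((s - t, y - x) : ℝ × E)‖ ^ 2}

/-- `V` is differentiable at `(t,x)` with (pair) gradient `q = (∂ₜV, ∇ₓV)`. -/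
def HasGradPair (W : ℝ → E → ℝ) (t : ℝ) (x : E) (q : ℝ × E) : Prop :=
  HasFDerivAt (fun sy : ℝ × E => W sy.1 sy.2)
    (q.1 • ContinuousLinearMap.fst ℝ ℝ E +
      (innerSL ℝ q.2).comp (ContinuousLinearMap.snd ℝ ℝ E)) (t, x)

/-- The reachable (limiting) gradient `∂*W(t,x)`. -/
def ReachGradPair (W : ℝ → E → ℝ) (t : ℝ) (x : E) : Set (ℝ × E) :=
  {q | ∃ u g : ℕ → ℝ × E,
    (∀ i, HasGradPair W (u i).1 (u i).2 (g i)) ∧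
    Tendsto u atTop (𝓝 (t, x)) ∧ Tendsto g atTop (𝓝 q)}

/-- Normal cone (of convex analysis) to `A` at `z`. -/
def normalConeAt (A : Set E) (z : E) : Set E :=
  {p | ∀ v ∈ A, ⟪p, v - z⟫ ≤ 0}

/-- `A` is `R`-convex. -/
def RConvex (A : Set E) (R : ℝ) : Prop :=
  ∀ z ∈ frontier A, ∀ y ∈ frontier A, ∀ n ∈ normalConeAt A z, ∀ m ∈ normalConeAt A y,
    ‖n‖ = 1 → ‖m‖ = 1 → ‖z - y‖ ≤ R * ‖n - m‖

/-- `F` is locally strongly convex. -/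
def LocStronglyConvex (F : E → Set E) : Prop :=
  ∀ K : Set E, IsCompact K → ∃ R > (0:ℝ), ∀ x ∈ K, RConvex (F x) R

/-- `ℝⁿ` as a Euclidean space. -/
abbrev Euc (n : ℕ) : Type := EuclideanSpace ℝ (Fin n)

set_option linter.unusedSectionVars false

theorem exists_nearest_point {K : Set E} (hne : K.Nonempty) (hconv : Convex ℝ K)
    (hK : IsCompact K) (u : E) : ∃ p ∈ K, ∀ w ∈ K, ⟪u - p, w - p⟫ ≤ 0 := by
  obtain ⟨p, hp, h⟩ := exists_norm_eq_iInf_of_complete_convex hne hK.isComplete hconv u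
  exact ⟨p, hp, (norm_eq_iInf_iff_real_inner_le_zero hconv hp).1 h⟩

theorem norm_sub_le_of_inner_nonpos {u p w : E} (h : ⟪u - p, w - p⟫ ≤ 0) :
    ‖u - p‖ ≤ ‖u - w‖ := by
  have h1 : ‖u - w‖ ^ 2 = ‖u - p‖ ^ 2 - 2 * ⟪u - p, w - p⟫ + ‖w - p‖ ^ 2 := by
    rw [← norm_sub_sq_real]; congr 2; abel
  have := sq_nonneg ‖w - p‖
  exact (sq_le_sq₀ (norm_nonneg _) (norm_nonneg _)).1 (by linarith)

/-- Stability of the nearest point with respect to the point and the set. -/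
theorem nearest_point_stability {A B : Set E} {u v p q : E} {ε : ℝ}
    (hp : p ∈ A) (hpA : ∀ w ∈ A, ⟪u - p, w - p⟫ ≤ 0)
    (hq : q ∈ B) (hqB : ∀ w ∈ B, ⟪v - q, w - q⟫ ≤ 0)
    (hAB : ∀ a ∈ A, ∃ b ∈ B, dist a b ≤ ε) (hBA : ∀ b ∈ B, ∃ a ∈ A, dist b a ≤ ε) :
    ‖p - q‖ ^ 2 ≤ ‖u - v‖ * ‖p - q‖ + ε * (‖u - p‖ + ‖v - q‖) := by
  obtain ⟨b, hb, hpb⟩ := hAB p hp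
  obtain ⟨a, ha, hqa⟩ := hBA q hq
  have h1 := hpA a ha
  have h2 := hqB b hb
  rw [dist_eq_norm] at hpb hqa
  have h3 : ⟪u - p, q - a⟫ ≤ ‖u - p‖ * ε :=
    (real_inner_le_norm _ _).trans (by gcongr)
  have h4 : ⟪v - q, p - b⟫ ≤ ‖v - q‖ * ε :=
    (real_inner_le_norm _ _).trans (by gcongr)
  have h5 : ⟪u - v, p - q⟫ ≤ ‖u - v‖ * ‖p - q‖ := real_inner_le_norm _ _
  have h6 : ‖p - q‖ ^ 2 = ⟪u - v, p - q⟫ + ⟪u - p, q - p⟫ + ⟪v - q, p - q⟫ := by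
    rw [← real_inner_self_eq_norm_sq, ← neg_sub p q, inner_neg_right, ← sub_eq_add_neg,
      ← inner_sub_left, ← inner_add_left]
    congr 1; abel
  have h7 : ⟪u - p, q - p⟫ = ⟪u - p, q - a⟫ + ⟪u - p, a - p⟫ := by
    rw [← inner_add_right]; congr 1; abel
  have h8 : ⟪v - q, p - q⟫ = ⟪v - q, p - b⟫ + ⟪v - q, b - q⟫ := by
    rw [← inner_add_right]; congr 1; abel
  linarith

/-- A bounded Lipschitz map with nonempty convex compact values admits a continuous
fibrewise nearest-point retraction. -/
theorem exists_continuous_retraction {G : E → Set E} {k M : ℝ} (hk : 0 ≤ k)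
    (hG : ∀ x, (G x).Nonempty ∧ Convex ℝ (G x) ∧ IsCompact (G x))
    (hlip : ∀ x y, ∀ a ∈ G x, ∃ b ∈ G y, dist a b ≤ k * dist x y)
    (hM : ∀ x, ∀ v ∈ G x, ‖v‖ ≤ M) :
    ∃ P : E → E → E, (Continuous fun z : E × E => P z.1 z.2) ∧ (∀ x v, P x v ∈ G x) ∧
      ∀ x y, ∀ v ∈ G y, ‖P x v - v‖ ≤ k * ‖x - y‖ := by
  choose P hPmem hP using fun x u => exists_nearest_point (hG x).1 (hG x).2.1 (hG x).2.2 u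
  refine ⟨P, ?_, hPmem, ?_⟩
  · rw [continuous_iff_continuousAt]
    rintro ⟨x, u⟩
    have hst : ∀ z : E × E, ‖P z.1 z.2 - P x u‖ ^ 2 ≤
        ‖z.2 - u‖ * (2 * M) + k * ‖z.1 - x‖ * (‖z.2‖ + M + (‖u‖ + M)) := by
      intro z
      have h := nearest_point_stability (hPmem z.1 z.2) (hP z.1 z.2) (hPmem x u) (hP x u)
        (hlip z.1 x) (by simpa only [dist_comm] using hlip x z.1)
      have h1 := hM _ _ (hPmem z.1 z.2)
      have h2 := hM _ _ (hPmem x u)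
      rw [dist_eq_norm] at h
      refine h.trans ?_
      gcongr
      · linarith [norm_sub_le (P z.1 z.2) (P x u)]
      · linarith [norm_sub_le z.2 (P z.1 z.2)]
      · linarith [norm_sub_le u (P x u)]
    have hlim : Tendsto (fun z : E × E =>
        ‖z.2 - u‖ * (2 * M) + k * ‖z.1 - x‖ * (‖z.2‖ + M + (‖u‖ + M))) (𝓝 (x, u)) (𝓝 0) := by
      have : Continuous (fun z : E × E =>
        ‖z.2 - u‖ * (2 * M) + k * ‖z.1 - x‖ * (‖z.2‖ + M + (‖u‖ + M))) := by fun_prop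
      simpa using this.tendsto (x, u)
    have hsq : Tendsto (fun z : E × E => ‖P z.1 z.2 - P x u‖ ^ 2) (𝓝 (x, u)) (𝓝 0) :=
      squeeze_zero (fun _ => sq_nonneg _) hst hlim
    have := hsq.sqrt
    simp only [Real.sqrt_sq (norm_nonneg _), Real.sqrt_zero] at this
    exact tendsto_iff_norm_sub_tendsto_zero.2 this
  · intro x y v hv
    obtain ⟨b, hb, hvb⟩ := hlip y x v hv
    have := norm_sub_le_of_inner_nonpos (hP x v b hb)
    rw [norm_sub_rev]
    rw [dist_comm y x, dist_eq_norm, dist_eq_norm] at hvb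
    exact this.trans hvb

/-- The nearest-point retraction onto a compact convex set is nonexpansive. -/
theorem exists_nonexpansive_retraction {K : Set E} (hne : K.Nonempty) (hconv : Convex ℝ K)
    (hK : IsCompact K) : ∃ π : E → E, (∀ x, π x ∈ K) ∧ (∀ x ∈ K, π x = x) ∧
      ∀ x y, dist (π x) (π y) ≤ dist x y := by
  choose π hmem hπ using exists_nearest_point hne hconv hK
  refine ⟨π, hmem, fun x hx => ?_, fun x y => ?_⟩
  · have := norm_sub_le_of_inner_nonpos (hπ x x hx)
    rw [sub_self, norm_zero, norm_le_zero_iff, sub_eq_zero] at this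
    exact this.symm
  · have h := nearest_point_stability (ε := 0) (hmem x) (hπ x) (hmem y) (hπ y)
      (fun a ha => ⟨a, ha, by simp⟩) (fun a ha => ⟨a, ha, by simp⟩)
    rw [dist_eq_norm, dist_eq_norm]
    rcases (norm_nonneg (π x - π y)).eq_or_lt with h0 | h0
    · rw [← h0]; positivity
    · nlinarith

theorem ACArc.intervalIntegrable_sub {s T : ℝ} {y y' : ℝ → E} (h : ACArc s T y y') {a b : ℝ}
    (ha : a ∈ Icc s T) (hb : b ∈ Icc s T) : IntervalIntegrable y' volume a b :=
  h.1.mono_set (uIcc_subset_uIcc (Icc_subset_uIcc ha) (Icc_subset_uIcc hb))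

theorem ACArc.sub_eq_integral {s T : ℝ} {y y' : ℝ → E} (h : ACArc s T y y') {a b : ℝ}
    (ha : a ∈ Icc s T) (hb : b ∈ Icc s T) : y b - y a = ∫ r in a..b, y' r := by
  have hs : s ∈ Icc s T := ⟨le_rfl, ha.1.trans ha.2⟩
  rw [h.2.1 a ha, h.2.1 b hb, add_sub_add_left_eq_sub,
    intervalIntegral.integral_interval_sub_left (h.intervalIntegrable_sub hs hb)
      (h.intervalIntegrable_sub hs ha)]

theorem ACArc.continuousOn {s T : ℝ} {y y' : ℝ → E} (h : ACArc s T y y') :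
    ContinuousOn y (Icc s T) := by
  rcases lt_or_ge T s with hT | hT
  · simp [Icc_eq_empty hT.not_ge]
  have h1 := intervalIntegral.continuousOn_primitive_interval' h.1 (left_mem_uIcc)
  rw [uIcc_of_le hT] at h1
  exact (continuousOn_const.add h1).congr fun t ht => h.2.1 t ht

theorem ACArc.mono {s T t : ℝ} {y y' : ℝ → E} (h : ACArc s T y y') (ht : t ∈ Icc s T) :
    ACArc t T y y' := by
  have hT : T ∈ Icc s T := ⟨ht.1.trans ht.2, le_rfl⟩
  refine ⟨h.intervalIntegrable_sub ht hT, fun u hu => ?_, ?_⟩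
  · rw [← h.sub_eq_integral ht ⟨ht.1.trans hu.1, hu.2⟩]; abel
  · filter_upwards [h.2.2] with u hu hu' using hu ⟨ht.1.trans hu'.1, hu'.2⟩

theorem IsTraj.mono {F : E → Set E} {s T t : ℝ} {y y' : ℝ → E} (h : IsTraj F s T y y')
    (ht : t ∈ Icc s T) : IsTraj F t T y y' := by
  refine ⟨h.1.mono ht, ?_⟩
  filter_upwards [h.2] with u hu hu' using hu ⟨ht.1.trans hu'.1, hu'.2⟩

theorem mul_integral_exp_le {c s t : ℝ} :
    2 * c * ∫ σ in s..t, Real.exp (2 * c * (σ - s)) ≤ Real.exp (2 * c * (t - s)) := by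
  have h : ∀ x ∈ uIcc s t, HasDerivAt (fun σ => Real.exp (2 * c * (σ - s)))
      (2 * c * Real.exp (2 * c * (x - s))) x := by
    intro x _
    have := (((hasDerivAt_id x).sub_const s).const_mul (2 * c)).exp
    simpa [mul_comm] using this
  rw [← intervalIntegral.integral_const_mul,
    intervalIntegral.integral_eq_sub_of_hasDerivAt h
      (Continuous.intervalIntegrable (by fun_prop) _ _)]
  simp

/-- A priori bound for trajectories of a differential inclusion with sublinear growth. -/
theorem IsTraj.norm_le {F : E → Set E} {r s T : ℝ} (hr : 0 ≤ r)
    (hF : ∀ x, ∀ v ∈ F x, ‖v‖ ≤ r * (1 + ‖x‖)) {y y' : ℝ → E} (h : IsTraj F s T y y')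
    {t : ℝ} (ht : t ∈ Icc s T) :
    ‖y t‖ ≤ 2 * (1 + ‖y s‖) * Real.exp (2 * r * (T - s)) := by
  have hcont : ContinuousOn (fun τ => Real.exp (-(2 * r * (τ - s))) * (1 + ‖y τ‖)) (Icc s T) :=
    ContinuousOn.mul (by fun_prop) (continuousOn_const.add h.1.continuousOn.norm)
  obtain ⟨u, hu, hmax⟩ := isCompact_Icc.exists_isMaxOn ⟨t, ht⟩ hcont
  set m := Real.exp (-(2 * r * (u - s))) * (1 + ‖y u‖) with hm
  have hle : ∀ τ ∈ Icc s T, 1 + ‖y τ‖ ≤ m * Real.exp (2 * r * (τ - s)) := by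
    intro τ hτ
    have h1 : Real.exp (-(2 * r * (τ - s))) * (1 + ‖y τ‖) ≤ m := hmax hτ
    rwa [Real.exp_neg, inv_mul_le_iff₀ (Real.exp_pos _), mul_comm] at h1
  have hs : s ∈ Icc s T := ⟨le_rfl, ht.1.trans ht.2⟩
  have hint : ‖y u - y s‖ ≤ ∫ τ in s..u, r * (m * Real.exp (2 * r * (τ - s))) := by
    rw [h.1.sub_eq_integral hs hu]
    refine intervalIntegral.norm_integral_le_of_norm_le hu.1 ?_
      (Continuous.intervalIntegrable (by fun_prop) _ _)
    filter_upwards [h.2] with τ hτ hτ'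
    have hτI : τ ∈ Icc s T := ⟨hτ'.1.le, hτ'.2.trans hu.2⟩
    exact (hF _ _ (hτ hτI)).trans (by gcongr; exact hle τ hτI)
  have hexp := mul_integral_exp_le (c := r) (s := s) (t := u)
  rw [intervalIntegral.integral_const_mul, intervalIntegral.integral_const_mul] at hint
  have hm0 : 0 ≤ m := by positivity
  have h2 : ‖y u - y s‖ ≤ m / 2 * Real.exp (2 * r * (u - s)) := by
    nlinarith [mul_le_mul_of_nonneg_left hexp hm0]
  have h3 : m ≤ 2 * (1 + ‖y s‖) := by
    have h4 : 1 + ‖y u‖ = m * Real.exp (2 * r * (u - s)) := by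
      rw [hm, Real.exp_neg]; field_simp
    have h5 : ‖y u‖ ≤ ‖y s‖ + ‖y u - y s‖ := by
      simpa using norm_add_le (y s) (y u - y s)
    have h6 : 1 ≤ Real.exp (2 * r * (u - s)) :=
      Real.one_le_exp (mul_nonneg (by positivity) (sub_nonneg.2 hu.1))
    have h7 : m * Real.exp (2 * r * (u - s)) ≤
        (2 * (1 + ‖y s‖)) * Real.exp (2 * r * (u - s)) := by
      nlinarith [norm_nonneg (y s)]
    exact le_of_mul_le_mul_right h7 (Real.exp_pos _)
  have h8 := hle t ht
  have h9 : Real.exp (2 * r * (t - s)) ≤ Real.exp (2 * r * (T - s)) := by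
    gcongr; exact ht.2
  calc ‖y t‖ ≤ m * Real.exp (2 * r * (t - s)) := by linarith
    _ ≤ _ := by gcongr

/-- Filippov's theorem for a map admitting a continuous fibrewise retraction: every trajectory
can be followed, from any other initial point, by a trajectory that stays Lipschitz close. -/
theorem IsTraj.exists_close {G : E → Set E} {P : E → E → E} {k M s T : ℝ} (hk : 0 ≤ k)
    (hsT : s ≤ T) (hPc : Continuous fun z : E × E => P z.1 z.2) (hPmem : ∀ x v, P x v ∈ G x)
    (hPk : ∀ x y, ∀ v ∈ G y, ‖P x v - v‖ ≤ k * ‖x - y‖) (hM : ∀ x, ∀ v ∈ G x, ‖v‖ ≤ M)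
    {y y' : ℝ → E} (h : IsTraj G s T y y') (ξ : E) :
    ∃ z z' : ℝ → E, IsTraj G s T z z' ∧ z s = ξ ∧
      ‖z T - y T‖ ≤ (1 + 2 * k * (T - s) * Real.exp (2 * k * (T - s))) * ‖ξ - y s‖ := by
  have hfix : ∀ x, ∀ v ∈ G x, P x v = v := fun x v hv => by
    simpa [sub_eq_zero] using hPk x x v hv
  have hs : s ∈ Icc s T := ⟨le_rfl, hsT⟩
  have hT : T ∈ Icc s T := ⟨hsT, le_rfl⟩
  set D := k * ‖ξ - y s‖ with hD
  have hD0 : 0 ≤ D := by positivity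
  set μ : Measure ℝ := volume.restrict (Icc s T) with hμ
  have hInt : ∀ w : ℝ → E, AEStronglyMeasurable w μ → (∀ τ ∈ Icc s T, ‖w τ‖ ≤ M) →
      IntervalIntegrable w volume s T := by
    intro w hw hb
    rw [intervalIntegrable_iff_integrableOn_Icc_of_le hsT]
    refine Integrable.of_bound hw M ?_
    exact (ae_restrict_iff' measurableSet_Icc).2 (Eventually.of_forall hb)
  have hsub : ∀ w : ℝ → E, IntervalIntegrable w volume s T → ∀ τ ∈ Icc s T,
      IntervalIntegrable w volume s τ := fun w hw τ hτ =>
    hw.mono_set (uIcc_subset_uIcc left_mem_uIcc (Icc_subset_uIcc hτ))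
  obtain ⟨v, hv0, hvs⟩ : ∃ v : ℕ → ℝ → E, (v 0 = fun τ => P (y τ) (y' τ)) ∧
      ∀ i, v (i + 1) = fun τ => P (ξ + ∫ σ in s..τ, v i σ) (v i τ) :=
    ⟨fun i => Nat.rec (fun τ => P (y τ) (y' τ))
      (fun _ w τ => P (ξ + ∫ σ in s..τ, w σ) (w τ)) i, rfl, fun _ => rfl⟩
  have hbd : ∀ i τ, ‖v i τ‖ ≤ M := by
    rintro (_ | i) τ
    · rw [hv0]; exact hM _ _ (hPmem _ _)
    · rw [hvs]; exact hM _ _ (hPmem _ _)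
  have hmeas : ∀ i, AEStronglyMeasurable (v i) μ := by
    intro i
    induction i with
    | zero =>
      rw [hv0]
      have h1 : AEStronglyMeasurable y μ :=
        h.1.continuousOn.aestronglyMeasurable_of_isCompact isCompact_Icc measurableSet_Icc
      have h2 : AEStronglyMeasurable y' μ :=
        ((intervalIntegrable_iff_integrableOn_Icc_of_le hsT).1 h.1.1).aestronglyMeasurable
      exact hPc.comp_aestronglyMeasurable (h1.prodMk h2)
    | succ i ih =>
      rw [hvs]
      have h1 := intervalIntegral.continuousOn_primitive_interval'
        (hInt _ ih fun τ _ => hbd i τ) left_mem_uIcc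
      rw [uIcc_of_le hsT] at h1
      have h2 : AEStronglyMeasurable (fun τ => ξ + ∫ σ in s..τ, v i σ) μ :=
        (continuousOn_const.add h1).aestronglyMeasurable_of_isCompact isCompact_Icc
          measurableSet_Icc
      exact hPc.comp_aestronglyMeasurable (h2.prodMk ih)
  have hii : ∀ i, IntervalIntegrable (v i) volume s T := fun i =>
    hInt _ (hmeas i) fun τ _ => hbd i τ
  have hy : ∀ τ ∈ Icc s T, y τ = y s + ∫ σ in s..τ, v 0 σ := by
    intro τ hτ
    rw [h.1.2.1 τ hτ, hv0]
    congr 1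
    refine intervalIntegral.integral_congr_ae ?_
    filter_upwards [h.2] with σ hσ hσ'
    rw [uIoc_of_le hτ.1] at hσ'
    exact (hfix _ _ (hσ ⟨hσ'.1.le, hσ'.2.trans hτ.2⟩)).symm
  have hstep : ∀ i, ∀ τ ∈ Icc s T,
      dist (v i τ) (v (i + 1) τ) ≤ D * Real.exp (2 * k * (τ - s)) * (1 / 2) ^ i := by
    intro i
    induction i with
    | zero =>
      intro τ hτ
      have h0 : v 0 τ ∈ G (y τ) := by rw [hv0]; exact hPmem _ _
      have h1 := hPk (ξ + ∫ σ in s..τ, v 0 σ) _ _ h0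
      rw [hy τ hτ, add_sub_add_right_eq_sub] at h1
      rw [dist_comm, dist_eq_norm, hvs, pow_zero, mul_one]
      have h2 : 1 ≤ Real.exp (2 * k * (τ - s)) :=
        Real.one_le_exp (mul_nonneg (by positivity) (sub_nonneg.2 hτ.1))
      exact h1.trans (le_mul_of_one_le_right hD0 h2)
    | succ i ih =>
      intro τ hτ
      have h0 : v (i + 1) τ ∈ G (ξ + ∫ σ in s..τ, v i σ) := by rw [hvs]; exact hPmem _ _
      have h1 := hPk (ξ + ∫ σ in s..τ, v (i + 1) σ) _ _ h0
      rw [add_sub_add_left_eq_sub, ← intervalIntegral.integral_sub (hsub _ (hii _) τ hτ)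
        (hsub _ (hii _) τ hτ)] at h1
      have h2 : ‖∫ σ in s..τ, v (i + 1) σ - v i σ‖ ≤
          ∫ σ in s..τ, D * (1 / 2) ^ i * Real.exp (2 * k * (σ - s)) := by
        refine intervalIntegral.norm_integral_le_of_norm_le hτ.1 (Eventually.of_forall ?_)
          (Continuous.intervalIntegrable (by fun_prop) _ _)
        intro σ hσ
        rw [← dist_eq_norm, dist_comm]
        exact (ih σ ⟨hσ.1.le, hσ.2.trans hτ.2⟩).trans_eq (by ring)
      rw [intervalIntegral.integral_const_mul] at h2
      have h3 := mul_integral_exp_le (c := k) (s := s) (t := τ)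
      rw [dist_comm, dist_eq_norm, hvs (i + 1)]
      refine h1.trans ?_
      have h4 : 0 ≤ D * (1 / 2) ^ i := by positivity
      calc k * ‖∫ σ in s..τ, v (i + 1) σ - v i σ‖
          ≤ k * (D * (1 / 2) ^ i * ∫ σ in s..τ, Real.exp (2 * k * (σ - s))) := by gcongr
        _ = D * (1 / 2) ^ i / 2 * (2 * k * ∫ σ in s..τ, Real.exp (2 * k * (σ - s))) := by ring
        _ ≤ D * (1 / 2) ^ i / 2 * Real.exp (2 * k * (τ - s)) := by gcongr
        _ = _ := by ring
  have hconv : ∀ τ, τ ∈ Icc s T → ∃ l, Tendsto (fun i => v i τ) atTop (𝓝 l) := fun τ hτ =>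
    cauchySeq_tendsto_of_complete
      (cauchySeq_of_le_geometric _ _ (by norm_num) fun i => hstep i τ hτ)
  choose! z' hz' using hconv
  have hz'bd : ∀ τ ∈ Icc s T, ‖z' τ‖ ≤ M := fun τ hτ =>
    le_of_tendsto (hz' τ hτ).norm (Eventually.of_forall fun i => hbd i τ)
  have hz'meas : AEStronglyMeasurable z' μ :=
    aestronglyMeasurable_of_tendsto_ae atTop hmeas
      ((ae_restrict_iff' measurableSet_Icc).2 (Eventually.of_forall hz'))
  have hz'int : IntervalIntegrable z' volume s T := hInt _ hz'meas hz'bd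
  refine ⟨fun τ => ξ + ∫ σ in s..τ, z' σ, z', ⟨⟨hz'int, fun τ _ => by simp, ?_⟩, ?_⟩,
    by simp, ?_⟩
  · filter_upwards [hz'int.ae_hasDerivAt_integral] with τ hτ hτ'
    exact (hτ (Icc_subset_uIcc hτ') s left_mem_uIcc).const_add ξ
  · refine Eventually.of_forall fun τ hτ => ?_
    have h1 : Tendsto (fun i => ∫ σ in s..τ, v i σ) atTop (𝓝 (∫ σ in s..τ, z' σ)) := by
      refine intervalIntegral.tendsto_integral_filter_of_dominated_convergence (fun _ => M)
        (Eventually.of_forall fun i => ?_)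
        (Eventually.of_forall fun i => Eventually.of_forall fun σ _ => hbd i σ)
        (by simp) (Eventually.of_forall fun σ hσ => ?_)
      · exact (hsub _ (hii i) τ hτ).def'.aestronglyMeasurable
      · rw [uIoc_of_le hτ.1] at hσ
        exact hz' σ ⟨hσ.1.le, hσ.2.trans hτ.2⟩
    have h2 : Tendsto (fun i => P (ξ + ∫ σ in s..τ, v i σ) (v i τ)) atTop
        (𝓝 (P (ξ + ∫ σ in s..τ, z' σ) (z' τ))) :=
      (hPc.tendsto _).comp ((h1.const_add ξ).prodMk_nhds (hz' τ hτ))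
    have h3 : Tendsto (fun i => v (i + 1) τ) atTop (𝓝 (z' τ)) :=
      (tendsto_add_atTop_iff_nat 1).2 (hz' τ hτ)
    simp only [hvs] at h3
    rw [tendsto_nhds_unique h3 h2]
    exact hPmem _ _
  · have hclose : ∀ τ ∈ Icc s T, ‖z' τ - v 0 τ‖ ≤ 2 * D * Real.exp (2 * k * (T - s)) := by
      intro τ hτ
      have h1 := dist_le_of_le_geometric_of_tendsto₀ _ _ (by norm_num)
        (fun i => hstep i τ hτ) (hz' τ hτ)
      rw [dist_comm, dist_eq_norm] at h1
      have h2 : Real.exp (2 * k * (τ - s)) ≤ Real.exp (2 * k * (T - s)) := by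
        gcongr; exact hτ.2
      have h3 := mul_le_mul_of_nonneg_left h2 hD0
      calc ‖z' τ - v 0 τ‖ ≤ _ := h1
        _ = 2 * (D * Real.exp (2 * k * (τ - s))) := by ring
        _ ≤ _ := by linarith
    have h1 : ‖∫ σ in s..T, z' σ - v 0 σ‖ ≤ 2 * D * Real.exp (2 * k * (T - s)) * |T - s| := by
      refine intervalIntegral.norm_integral_le_of_norm_le_const fun σ hσ => ?_
      rw [uIoc_of_le hsT] at hσ
      exact hclose σ ⟨hσ.1.le, hσ.2⟩
    rw [abs_of_nonneg (sub_nonneg.2 hsT)] at h1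
    rw [hy T hT, add_sub_add_comm, ← intervalIntegral.integral_sub hz'int (hii 0)]
    refine (norm_add_le _ _).trans ?_
    rw [hD] at h1
    linarith

/-- On bounded sets, the Hausdorff local Lipschitz condition yields a uniform constant. -/
theorem StandingHyp.exists_lipschitz_on_closedBall [ProperSpace E] {F : E → Set E}
    (hF : StandingHyp F) (R : ℝ) : ∃ k : ℝ, 0 ≤ k ∧ ∀ x ∈ closedBall (0 : E) R,
      ∀ y ∈ closedBall (0 : E) R, ∀ a ∈ F x, ∃ b ∈ F y, dist a b ≤ k * dist x y := by
  let Φ : E → TopologicalSpace.NonemptyCompacts E := fun x => ⟨⟨F x, (hF.1 x).2.2⟩, (hF.1 x).1⟩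
  have hΦ : LocallyLipschitz Φ := by
    intro x
    obtain ⟨ε, hε, c, hc, h⟩ := hF.2.1 x
    refine ⟨⟨c, hc⟩, ball x ε, ball_mem_nhds x hε, fun y hy z hz => (h y hy z hz).trans ?_⟩
    rw [ENNReal.ofReal_mul hc, edist_dist, ENNReal.ofReal_eq_coe_nnreal hc]
    rfl
  obtain ⟨k, hk⟩ := (hΦ.locallyLipschitzOn
    (s := closedBall (0 : E) R)).exists_lipschitzOnWith_of_compact (isCompact_closedBall _ _)
  refine ⟨k, k.2, fun x hx y hy a ha => ?_⟩
  obtain ⟨b, hb, hab⟩ := (hF.1 y).2.2.exists_infEDist_eq_edist (hF.1 y).1 a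
  refine ⟨b, hb, ?_⟩
  have h1 : edist a b ≤ k * edist x y :=
    hab ▸ (infEDist_le_hausdorffEDist_of_mem ha).trans (hk hx hy)
  rw [edist_dist, edist_dist, ← ENNReal.ofReal_coe_nnreal, ← ENNReal.ofReal_mul k.coe_nonneg] at h1
  exact (ENNReal.ofReal_le_ofReal_iff (by positivity)).1 h1

/-- Filippov's theorem under the standing hypotheses, with a constant that is uniform over
bounded trajectories and bounded time intervals. -/
theorem StandingHyp.exists_close [ProperSpace E] {F : E → Set E} (hF : StandingHyp F) {r R L : ℝ}
    (hr : 0 ≤ r) (hgrow : ∀ x, ∀ v ∈ F x, ‖v‖ ≤ r * (1 + ‖x‖)) (hR : 0 ≤ R) :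
    ∃ C : ℝ, 0 ≤ C ∧ ∀ s T : ℝ, s ≤ T → T - s ≤ L → ∀ y y' : ℝ → E, IsTraj F s T y y' →
      (∀ τ ∈ Icc s T, ‖y τ‖ ≤ R) → ∀ ξ : E, 2 * (1 + ‖ξ‖) * Real.exp (2 * r * L) ≤ R →
      ∃ z z' : ℝ → E, IsTraj F s T z z' ∧ z s = ξ ∧ (∀ τ ∈ Icc s T, ‖z τ‖ ≤ R) ∧
        ‖z T - y T‖ ≤ C * ‖ξ - y s‖ := by
  obtain ⟨k, hk, hlip⟩ := hF.exists_lipschitz_on_closedBall R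
  obtain ⟨π, hπmem, hπid, hπ⟩ := exists_nonexpansive_retraction
    (nonempty_closedBall.2 hR) (convex_closedBall (0 : E) R) (isCompact_closedBall _ _)
  have hπnorm : ∀ x, ‖π x‖ ≤ ‖x‖ := fun x => by
    simpa [hπid 0 (mem_closedBall_self hR)] using hπ x 0
  have hπR : ∀ x, ‖π x‖ ≤ R := fun x => by simpa using hπmem x
  have hπid' : ∀ x, ‖x‖ ≤ R → π x = x := fun x hx => hπid x (by simpa using hx)
  obtain ⟨P, hPc, hPmem, hPk⟩ := exists_continuous_retraction (G := fun x => F (π x))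
    (M := r * (1 + R)) hk (fun x => hF.1 (π x))
    (fun x y a ha => by
      obtain ⟨b, hb, hab⟩ := hlip _ (hπmem x) _ (hπmem y) a ha
      exact ⟨b, hb, hab.trans (by gcongr; exact hπ x y)⟩)
    (fun x v hv => (hgrow _ v hv).trans (by gcongr; exact hπR x))
  have hM : ∀ x, ∀ v ∈ F (π x), ‖v‖ ≤ r * (1 + R) := fun x v hv =>
    (hgrow _ v hv).trans (by gcongr; exact hπR x)
  refine ⟨1 + 2 * k * |L| * Real.exp (2 * k * L), by positivity, ?_⟩
  intro s T hsT hL y y' hy hyR ξ hξ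
  have hyG : IsTraj (fun x => F (π x)) s T y y' := by
    refine ⟨hy.1, ?_⟩
    filter_upwards [hy.2] with τ hτ hτ'
    rw [hπid' _ (hyR τ hτ')]
    exact hτ hτ'
  obtain ⟨z, z', hz, hzs, hzT⟩ := hyG.exists_close hk hsT hPc hPmem hPk hM ξ
  have hzR : ∀ τ ∈ Icc s T, ‖z τ‖ ≤ R := by
    intro τ hτ
    refine (hz.norm_le hr (fun x v hv => (hgrow _ v hv).trans ?_) hτ).trans (le_trans ?_ hξ)
    · gcongr; exact hπnorm x
    · rw [hzs]; gcongr
  refine ⟨z, z', ⟨hz.1, ?_⟩, hzs, hzR, hzT.trans ?_⟩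
  · filter_upwards [hz.2] with τ hτ hτ'
    have := hτ hτ'
    rwa [hπid' _ (hzR τ hτ')] at this
  · gcongr
    · exact hL.trans (le_abs_self L)

/-- A superdifferential inequality for the derivative of a function along a curve. -/
theorem FSuperPair.deriv_le {W : ℝ → E → ℝ} {x : ℝ → E} {x' q : E} {t a d : ℝ}
    (hx : HasDerivAt x x' t) (hW : HasDerivAt (fun s => W s (x s)) d t)
    (hq : (a, q) ∈ FSuperPair W t (x t)) : d ≤ a + ⟪q, x'⟫ := by
  have key : ∀ ε > 0, d ≤ a + ⟪q, x'⟫ + ε * (1 + ‖x'‖) := by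
    intro ε hε
    have hmono : 𝓝[>] t ≤ 𝓝[≠] t := nhdsWithin_mono _ fun s hs => ne_of_gt hs
    have h1 : Tendsto (slope (fun s => W s (x s)) t) (𝓝[>] t) (𝓝 d) :=
      (hasDerivAt_iff_tendsto_slope.1 hW).mono_left hmono
    have h2 : Tendsto (slope x t) (𝓝[>] t) (𝓝 x') :=
      (hasDerivAt_iff_tendsto_slope.1 hx).mono_left hmono
    have h3 : Tendsto (fun s => a + ⟪q, slope x t s⟫ + ε * (1 + ‖slope x t s‖)) (𝓝[>] t)
        (𝓝 (a + ⟪q, x'⟫ + ε * (1 + ‖x'‖))) :=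
      ((tendsto_const_nhds.inner h2).const_add a).add ((h2.norm.const_add 1).const_mul ε)
    refine le_of_tendsto_of_tendsto h1 h3 ?_
    have h4 : Tendsto (fun s => (s, x s)) (𝓝[>] t) (𝓝 (t, x t)) :=
      (tendsto_id.prodMk_nhds hx.continuousAt).mono_left nhdsWithin_le_nhds
    filter_upwards [h4.eventually (hq ε hε), self_mem_nhdsWithin] with s hs hts
    have hpos : 0 < s - t := sub_pos.2 hts
    have hxs : x s - x t = (s - t) • slope x t s := (sub_smul_slope x t s).symm
    have hWs : W s (x s) - W t (x t) = (s - t) * slope (fun s => W s (x s)) t s :=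
      (sub_smul_slope (fun s => W s (x s)) t s).symm
    simp only [hWs, hxs, inner_smul_right] at hs
    have h5 : ‖((s - t, (s - t) • slope x t s) : ℝ × E)‖ ≤ (s - t) * (1 + ‖slope x t s‖) := by
      rw [Prod.norm_def, norm_smul, Real.norm_of_nonneg hpos.le, mul_add, mul_one]
      exact max_le_add_of_nonneg hpos.le (by positivity)
    have h6 := mul_le_mul_of_nonneg_left h5 hε.le
    refine le_of_mul_le_mul_left ?_ hpos
    linarith
  refine le_of_forall_pos_le_add fun δ hδ => ?_
  have h0 : 0 < 1 + ‖x'‖ := by positivity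
  have := key (δ / (1 + ‖x'‖)) (by positivity)
  rwa [div_mul_cancel₀ _ h0.ne'] at this

/-- A function whose increments are at most linear and whose derivative, where it exists, is
almost everywhere nonpositive, does not increase. -/
theorem le_of_increment_le_of_ae_deriv_nonpos {g : ℝ → ℝ} {a b C : ℝ} (hab : a ≤ b)
    (hinc : ∀ t ∈ Icc a b, ∀ s ∈ Icc a b, t ≤ s → g s ≤ g t + C * (s - t))
    (hderiv : ∀ᵐ t, t ∈ Icc a b → ∀ d, HasDerivAt g d t → d ≤ 0) : g b ≤ g a := by
  set h : ℝ → ℝ := fun t => C * t - g t with hh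
  have hmono : MonotoneOn h (Icc a b) := fun t ht s hs hts => by
    have := hinc t ht s hs hts
    simp only [hh]; linarith
  rw [← uIcc_of_le hab] at hmono
  have hmem := hmono.intervalIntegral_deriv_mem_uIcc
  have hle : h a ≤ h b := hmono left_mem_uIcc right_mem_uIcc hab
  rw [uIcc_of_le (sub_nonneg.2 hle)] at hmem
  have hint : ∫ _ in a..b, C ≤ ∫ t in a..b, deriv h t := by
    refine intervalIntegral.integral_mono_ae_restrict hab (by simp)
      hmono.intervalIntegrable_deriv ?_
    rw [EventuallyLE, ← restrict_Ioo_eq_restrict_Icc, ae_restrict_iff' measurableSet_Ioo]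
    filter_upwards [hmono.ae_differentiableWithinAt_of_mem, hderiv] with t ht1 ht2 ht
    have htI := Ioo_subset_Icc_self ht
    rw [uIcc_of_le hab] at ht1
    have hd : DifferentiableAt ℝ h t := (ht1 htI).differentiableAt (Icc_mem_nhds ht.1 ht.2)
    have hg : HasDerivAt g (C - deriv h t) t := by
      have := ((hasDerivAt_id t).const_mul C).sub hd.hasDerivAt
      rw [mul_one] at this
      refine this.congr_of_eventuallyEq (Eventually.of_forall fun τ => ?_)
      simp [hh]
    linarith [ht2 htI _ hg]
  rw [intervalIntegral.integral_const, smul_eq_mul] at hint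
  have := hint.trans hmem.2
  simp only [hh] at this
  linarith

theorem valueFn_terminal {F : E → Set E} {φ : E → ℝ} {T : ℝ} {x x' : ℝ → E}
    (h : IsTraj F T T x x') : valueFn F φ T T (x T) = φ (x T) := by
  have : {r | ∃ y y' : ℝ → E, IsTraj F T T y y' ∧ y T = x T ∧ r = φ (y T)} = {φ (x T)} := by
    ext r
    constructor
    · rintro ⟨y, y', -, hy, rfl⟩
      rw [hy, mem_singleton_iff]
    · rintro rfl
      exact ⟨x, x', h, rfl, rfl⟩
  rw [valueFn, this, csInf_singleton]

/-- Theorem 2.8, sufficient conditions for optimality.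
Under (SH), if `x` is a trajectory of the differential inclusion on `[t₀,T]` with
`x(t₀)=x₀` and for a.e. `t` there exists `p(t)` with `⟪p(t),x'(t)⟫ = H(x(t),p(t))` and
`(H(x(t),p(t)), −p(t)) ∈ ∂⁺V(t,x(t))`, then `x` is optimal for `P(t₀,x₀)`. -/
theorem stmt12 {n : ℕ} (F : Euc n → Set (Euc n)) (φ : Euc n → ℝ)
    (t0 T : ℝ) (x0 : Euc n) (x x' : ℝ → Euc n)
    (hSH : StandingHyp F) (hφ : LocallyLipschitz φ) (ht : t0 < T)
    (htraj : IsTraj F t0 T x x') (hinit : x t0 = x0)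
    (hyp : ∀ᵐ t ∂volume, t ∈ Icc t0 T → ∃ p : Euc n,
      ⟪p, x' t⟫ = Ham F (x t) p ∧
      (Ham F (x t) p, -p) ∈ FSuperPair (valueFn F φ T) t (x t)) :
    IsOptimal F φ t0 T x0 x x' := by
  refine ⟨htraj, hinit, fun y y' hy hy0 => ?_⟩
  obtain ⟨r, hr, hgrow⟩ := hSH.2.2
  set L := T - t0 with hL
  set R₁ := 2 * (1 + ‖x0‖) * Real.exp (2 * r * L) with hR₁
  set R := 2 * (1 + R₁) * Real.exp (2 * r * L) with hR
  have hR₁0 : 0 ≤ R₁ := by positivity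
  have hR0 : 0 ≤ R := by positivity
  have ht0 : t0 ∈ Icc t0 T := ⟨le_rfl, ht.le⟩
  have hT : T ∈ Icc t0 T := ⟨ht.le, le_rfl⟩
  have hxR : ∀ t ∈ Icc t0 T, ‖x t‖ ≤ R₁ := fun t h => by
    simpa only [hinit] using htraj.norm_le hr.le hgrow h
  have hball : ∀ t ∈ Icc t0 T, ∀ z z' : ℝ → Euc n, IsTraj F t T z z' → z t = x t →
      ∀ τ ∈ Icc t T, ‖z τ‖ ≤ R := by
    intro t h z z' hz hzt τ hτ
    refine (hz.norm_le hr.le hgrow hτ).trans ?_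
    rw [hzt, hR]
    gcongr
    · exact hxR t h
    · exact sub_le_sub_left h.1 T
  obtain ⟨C, hC, hclose⟩ := hSH.exists_close (L := L) hr.le hgrow hR0
  obtain ⟨K, hK⟩ := (hφ.locallyLipschitzOn
    (s := closedBall (0 : Euc n) R)).exists_lipschitzOnWith_of_compact (isCompact_closedBall _ _)
  obtain ⟨m, hm⟩ := (isCompact_closedBall (0 : Euc n) R).bddBelow_image hφ.continuous.continuousOn
  have hle : ∀ t ∈ Icc t0 T, ∀ z z' : ℝ → Euc n, IsTraj F t T z z' → z t = x t →
      valueFn F φ T t (x t) ≤ φ (z T) := by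
    intro t h z z' hz hzt
    refine csInf_le ⟨m, ?_⟩ ⟨z, z', hz, hzt, rfl⟩
    rintro _ ⟨w, w', hw, hwt, rfl⟩
    exact hm (mem_image_of_mem φ (by simpa using hball t h w w' hw hwt T ⟨h.2, le_rfl⟩))
  have hinc : ∀ t ∈ Icc t0 T, ∀ s ∈ Icc t0 T, t ≤ s →
      valueFn F φ T s (x s) ≤
        valueFn F φ T t (x t) + K * (C * (2 * (r * (1 + R)))) * (s - t) := by
    intro t h s hs hts
    rw [← sub_le_iff_le_add]
    refine le_csInf ⟨_, x, x', htraj.mono h, rfl, rfl⟩ ?_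
    rintro _ ⟨w, w', hw, hwt, rfl⟩
    have hst : s ∈ Icc t T := ⟨hts, hs.2⟩
    have hwR := hball t h w w' hw hwt
    have hwT : ‖w T‖ ≤ R := hwR T ⟨h.2, le_rfl⟩
    obtain ⟨z, z', hz, hzs, hzR, hzT⟩ := hclose s T hs.2 (sub_le_sub_left hs.1 T) w w'
      (hw.mono hst) (fun τ hτ => hwR τ ⟨hts.trans hτ.1, hτ.2⟩) (x s)
      (by rw [hR]; gcongr; exact hxR s hs)
    have hspeed : ∀ u u' : ℝ → Euc n, IsTraj F t T u u' → u t = x t →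
        ‖u s - u t‖ ≤ r * (1 + R) * (s - t) := by
      intro u u' hu hut
      rw [hu.1.sub_eq_integral ⟨le_rfl, h.2⟩ hst, ← abs_of_nonneg (sub_nonneg.2 hts)]
      refine intervalIntegral.norm_integral_le_of_norm_le_const_ae ?_
      filter_upwards [hu.2] with τ hτ hτ'
      rw [uIoc_of_le hts] at hτ'
      have hτI : τ ∈ Icc t T := ⟨hτ'.1.le, hτ'.2.trans hs.2⟩
      refine (hgrow _ _ (hτ hτI)).trans ?_
      gcongr
      exact hball t h u u' hu hut τ hτI
    have h1 := hspeed w w' hw hwt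
    have h2 := hspeed x x' (htraj.mono h) rfl
    have h3 : ‖x s - w s‖ ≤ 2 * (r * (1 + R)) * (s - t) := by
      have h4 : x s - w s = (x s - x t) - (w s - w t) := by rw [hwt]; abel
      rw [h4]
      linarith [norm_sub_le (x s - x t) (w s - w t)]
    have h5 := hle s hs z z' hz hzs
    have h6 : φ (z T) - φ (w T) ≤ K * ‖z T - w T‖ := by
      have := hK.dist_le_mul (z T) (by simpa using hzR T ⟨hs.2, le_rfl⟩) (w T) (by simpa using hwT)
      rw [Real.dist_eq, dist_eq_norm] at this
      exact (le_abs_self _).trans this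
    have h7 : K * ‖z T - w T‖ ≤ K * (C * (2 * (r * (1 + R)) * (s - t))) := by
      gcongr
      exact hzT.trans (by gcongr)
    linarith
  have hmain : valueFn F φ T T (x T) ≤ valueFn F φ T t0 (x t0) := by
    refine le_of_increment_le_of_ae_deriv_nonpos
      (g := fun t => valueFn F φ T t (x t)) ht.le hinc ?_
    filter_upwards [hyp, htraj.1.2.2] with t h1 h2 h d hd
    obtain ⟨p, hp, hps⟩ := h1 h
    have := FSuperPair.deriv_le (h2 h) hd hps
    rw [inner_neg_left, hp] at this
    linarith
  rw [valueFn_terminal (htraj.mono hT)] at hmain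
  exact hmain.trans (hle t0 ht0 y y' hy (hy0.trans hinit.symm))

end
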